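/- arXiv:2102.06028 — 7 statements merged into one kernel-verified Lean document; each statement's English description precedes it below -/
import Mathlib

section
/- Let Σ be a finite alphabet, Σ_uc ⊆ Σ a set of uncontrollable events with Σ_c = Σ \ Σ_uc, Σ_o ⊆ Σ a set of observable events with natural projection P, and let L ⊆ Σ* be a nonempty prefix-closed language (the plant language). If K ⊆ L is a nonempty language that is controllable with respect to (L, Σ_uc) and observable with respect to (L, P, Σ_c), then there exists a partial-observation supervisor S such that L(S/G) = pr(K); consequently, defining the marked closed-loop language as M(S/G) := L(S/G) ∩ K, one has M(S/G) = K and L(S/G) = pr(K), i.e., S is a For-all attack supervisor: every string generated under supervision can be extended within L(S/G) to a string of M(S/G). -/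
/-! Abstract supervisory control theory notions over a finite alphabet `E`.
Languages are sets of finite strings (lists) over `E`. -/

variable {E : Type*}

/-- Prefix closure `pr(K)`: the set of all prefixes of strings of `K`. -/
def prefixClosure (K : Set (List E)) : Set (List E) := {s | ∃ t ∈ K, s <+: t}

/-- Controllability of `K` w.r.t. `(L, Euc)`. -/
def IsControllable (K L : Set (List E)) (Euc : Set E) : Prop :=
  ∀ s ∈ prefixClosure K, ∀ σ ∈ Euc, s ++ [σ] ∈ L → s ++ [σ] ∈ prefixClosure K

open Classical in
/-- Natural projection onto the observable events `Eo`: erases all events not in `Eo`. -/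
noncomputable def natProj (Eo : Set E) (s : List E) : List E :=
  s.filter (fun a => decide (a ∈ Eo))

/-- Observability of `K` w.r.t. `(L, P, Ec)`. -/
def IsObservable (K L : Set (List E)) (P : List E → List E) (Ec : Set E) : Prop :=
  ∀ s ∈ prefixClosure K, ∀ s' ∈ prefixClosure K, P s = P s' → ∀ σ ∈ Ec,
    s ++ [σ] ∈ prefixClosure K → s' ++ [σ] ∈ L → s' ++ [σ] ∈ prefixClosure K

/-- A partial-observation supervisor `S : Eo* → 𝒫(Σ)` together with the plant language `L`
induces the closed-loop language `L(S/G)`: `ε ∈ L(S/G)`, and `sσ ∈ L(S/G)` iff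
`s ∈ L(S/G)`, `sσ ∈ L`, and `σ ∈ S(P s)`. -/
inductive ClosedLoop (L : Set (List E)) (P : List E → List E) (S : List E → Set E) :
    List E → Prop
  | nil : ClosedLoop L P S []
  | snoc {s : List E} {σ : E} : ClosedLoop L P S s → (s ++ [σ]) ∈ L → σ ∈ S (P s) →
      ClosedLoop L P S (s ++ [σ])

theorem subset_prefixClosure (K : Set (List E)) : K ⊆ prefixClosure K :=
  fun s hs => ⟨s, hs, List.prefix_rfl⟩

theorem prefixClosure_mono {K L : Set (List E)} (h : K ⊆ L) :
    prefixClosure K ⊆ prefixClosure L :=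
  fun _ ⟨t, ht, hst⟩ => ⟨t, h ht, hst⟩

theorem mem_prefixClosure_of_prefix {K : Set (List E)} {s t : List E} (hst : s <+: t)
    (ht : t ∈ prefixClosure K) : s ∈ prefixClosure K :=
  let ⟨u, hu, htu⟩ := ht
  ⟨u, hu, hst.trans htu⟩

theorem nil_mem_prefixClosure {K : Set (List E)} (hK : K.Nonempty) : [] ∈ prefixClosure K :=
  let ⟨t, ht⟩ := hK
  ⟨t, ht, List.nil_prefix⟩

/-- The supervisor that enables, after the observation `w`, every uncontrollable event and every
event that continues within `pr(K)` some string of `pr(K)` observed as `w`. -/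
def permissiveSupervisor (K : Set (List E)) (P : List E → List E) (Euc : Set E)
    (w : List E) : Set E :=
  Euc ∪ {σ | ∃ s ∈ prefixClosure K, P s = w ∧ s ++ [σ] ∈ prefixClosure K}

theorem closedLoop_permissiveSupervisor_iff {K L : Set (List E)} {P : List E → List E}
    {Euc : Set E} (hKL : prefixClosure K ⊆ L) (hK : K.Nonempty) (hC : IsControllable K L Euc)
    (hO : IsObservable K L P Eucᶜ) {s : List E} :
    ClosedLoop L P (permissiveSupervisor K P Euc) s ↔ s ∈ prefixClosure K := by
  constructor
  · intro h
    induction h with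
    | nil => exact nil_mem_prefixClosure hK
    | @snoc s σ _ hL hS ih =>
      by_cases hσ : σ ∈ Euc
      · exact hC s ih σ hσ hL
      · obtain hS | ⟨s', hs', hP, hs'σ⟩ := hS
        · exact absurd hS hσ
        · exact hO s' hs' s ih hP σ hσ hs'σ hL
  · induction s using List.reverseRecOn with
    | nil => exact fun _ => .nil
    | append_singleton s σ ih =>
      intro h
      have hs := mem_prefixClosure_of_prefix (List.prefix_append s [σ]) h
      exact .snoc (ih hs) (hKL h) (Or.inr ⟨s, hs, rfl, h⟩)

/-- controllability and observability theorem, For-all attack supervisor: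
if `K ⊆ L` is nonempty, controllable w.r.t. `(L, Euc)` and observable w.r.t. `(L, P, Ec)`
(where `Ec = Σ \ Euc`), then there is a partial-observation supervisor `S` (admissible:
it always enables all uncontrollable events) with `L(S/G) = pr(K)`; defining
`M(S/G) = L(S/G) ∩ K`, one gets `M(S/G) = K`, and every string generated under supervision
extends within `L(S/G)` to a string of `M(S/G)`. -/
theorem stmt0 [Fintype E] (L K : Set (List E)) (Euc Eo : Set E)
    (hLpc : prefixClosure L = L) (hLne : L.Nonempty)
    (hKL : K ⊆ L) (hKne : K.Nonempty)
    (hC : IsControllable K L Euc)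
    (hO : IsObservable K L (natProj Eo) Eucᶜ) :
    ∃ S : List E → Set E,
      (∀ w : List E, Euc ⊆ S w) ∧
      {s | ClosedLoop L (natProj Eo) S s} = prefixClosure K ∧
      {s | ClosedLoop L (natProj Eo) S s} ∩ K = K ∧
      (∀ s, ClosedLoop L (natProj Eo) S s →
        ∃ t, ClosedLoop L (natProj Eo) S (s ++ t) ∧ (s ++ t) ∈ K) := by
  have hiff : ∀ s, ClosedLoop L (natProj Eo) (permissiveSupervisor K (natProj Eo) Euc) s ↔
      s ∈ prefixClosure K := fun _ =>
    closedLoop_permissiveSupervisor_iff ((prefixClosure_mono hKL).trans hLpc.subset) hKne hC hO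
  refine ⟨permissiveSupervisor K (natProj Eo) Euc, fun _ => Set.subset_union_left,
    Set.ext hiff, Set.inter_eq_right.2 fun s hs => (hiff s).2 (subset_prefixClosure K hs), ?_⟩
  intro s hs
  obtain ⟨_, hK, t, rfl⟩ := (hiff s).1 hs
  exact ⟨t, (hiff _).2 (subset_prefixClosure K hK), hK⟩
end

section
/- Let Σ be a finite alphabet, L ⊆ Σ* a prefix-closed language, Σ_o ⊆ Σ with natural projection P, and Σ_c ⊆ Σ. If K ⊆ L is normal with respect to (L, P), then K is observable with respect to (L, P, Σ_c). -/
/-! Abstract supervisory control theory notions over a finite alphabet `E`.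
Languages are sets of finite strings (lists) over `E`. -/

variable {E : Type*}

/-- Normality of `K` w.r.t. `(L, P)`: `pr(K) = P⁻¹(P(pr(K))) ∩ L`. -/
def IsNormalLang (K L : Set (List E)) (P : List E → List E) : Prop :=
  prefixClosure K = {s | ∃ t ∈ prefixClosure K, P s = P t} ∩ L

/-- if `K ⊆ L` is normal w.r.t. `(L, P)` (with `L` prefix-closed and
`P` the natural projection onto `Eo`), then `K` is observable w.r.t. `(L, P, Ec)`,
for any set of controllable events `Ec`. -/
theorem stmt1 [Fintype E] (L K : Set (List E)) (Eo Ec : Set E)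
    (hLpc : prefixClosure L = L) (hKL : K ⊆ L)
    (hN : IsNormalLang K L (natProj Eo)) :
    IsObservable K L (natProj Eo) Ec := by
  intro s _ s' _ hP σ _ hs hs'
  rw [hN]
  refine ⟨⟨s ++ [σ], hs, ?_⟩, hs'⟩
  simp only [natProj, List.filter_append] at hP ⊢
  rw [hP]
end

section
/- Let Σ be a finite alphabet, L ⊆ Σ* a prefix-closed language, M ⊆ L, Σ_uc ⊆ Σ, and Σ_o ⊆ Σ with natural projection P. Let 𝒞 be the family of all sublanguages K ⊆ M that are both controllable with respect to (L, Σ_uc) and normal with respect to (L, P). Then the union ⋃𝒞 of all members of 𝒞 is itself a sublanguage of M that is controllable with respect to (L, Σ_uc) and normal with respect to (L, P); hence the supremal controllable and normal sublanguage supCN(M) of M exists and equals ⋃𝒞. -/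
/-! Abstract supervisory control theory notions over a finite alphabet `E`.
Languages are sets of finite strings (lists) over `E`. -/

variable {E : Type*}

theorem mem_prefixClosure_sUnion {C : Set (Set (List E))} {s : List E} :
    s ∈ prefixClosure (⋃₀ C) ↔ ∃ K ∈ C, s ∈ prefixClosure K := by
  constructor
  · rintro ⟨t, ⟨K, hK, ht⟩, hst⟩
    exact ⟨K, hK, t, ht, hst⟩
  · rintro ⟨K, hK, t, ht, hst⟩
    exact ⟨t, ⟨K, hK, ht⟩, hst⟩

theorem IsControllable.sUnion {C : Set (Set (List E))} {L : Set (List E)} {Euc : Set E}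
    (hC : ∀ K ∈ C, IsControllable K L Euc) : IsControllable (⋃₀ C) L Euc := by
  intro s hs σ hσ hL
  obtain ⟨K, hK, hs⟩ := mem_prefixClosure_sUnion.1 hs
  exact mem_prefixClosure_sUnion.2 ⟨K, hK, hC K hK s hs σ hσ hL⟩

theorem IsNormalLang.sUnion {C : Set (Set (List E))} {L : Set (List E)} {P : List E → List E}
    (hC : ∀ K ∈ C, IsNormalLang K L P) : IsNormalLang (⋃₀ C) L P := by
  apply Set.Subset.antisymm
  · intro s hs
    obtain ⟨K, hK, hsK⟩ := mem_prefixClosure_sUnion.1 hs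
    exact ⟨⟨s, hs, rfl⟩, ((hC K hK).subset hsK).2⟩
  · rintro s ⟨⟨t, ht, hst⟩, hsL⟩
    obtain ⟨K, hK, ht⟩ := mem_prefixClosure_sUnion.1 ht
    exact mem_prefixClosure_sUnion.2 ⟨K, hK, (hC K hK).superset ⟨⟨t, ht, hst⟩, hsL⟩⟩

/-- the family `𝒞` of sublanguages of `M` that are controllable w.r.t.
`(L, Euc)` and normal w.r.t. `(L, P)` is closed under (arbitrary) union: `⋃₀ 𝒞` is itself
a member of `𝒞` and contains every member, i.e. the supremal controllable and normal
sublanguage `supCN(M)` exists and equals `⋃₀ 𝒞`. -/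
theorem stmt3 [Fintype E] (L M : Set (List E)) (Euc Eo : Set E)
    (hLpc : prefixClosure L = L) (hML : M ⊆ L) :
    letI C : Set (Set (List E)) :=
      {K | K ⊆ M ∧ IsControllable K L Euc ∧ IsNormalLang K L (natProj Eo)}
    ⋃₀ C ⊆ M ∧ IsControllable (⋃₀ C) L Euc ∧ IsNormalLang (⋃₀ C) L (natProj Eo) ∧
    ⋃₀ C ∈ C ∧ ∀ K ∈ C, K ⊆ ⋃₀ C := by
  set C : Set (Set (List E)) :=
    {K | K ⊆ M ∧ IsControllable K L Euc ∧ IsNormalLang K L (natProj Eo)}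
  have hM : ⋃₀ C ⊆ M := Set.sUnion_subset fun K hK => hK.1
  have hc : IsControllable (⋃₀ C) L Euc := IsControllable.sUnion fun K hK => hK.2.1
  have hn : IsNormalLang (⋃₀ C) L (natProj Eo) := IsNormalLang.sUnion fun K hK => hK.2.2
  exact ⟨hM, hc, hn, ⟨hM, hc, hn⟩, fun K hK => Set.subset_sUnion_of_mem hK⟩
end

section
/- Let Σ be a finite alphabet, L ⊆ Σ* a prefix-closed language, M ⊆ L, and Σ_uc ⊆ Σ. Suppose there exists a string t ∈ L such that (i) every event occurring in t belongs to Σ_uc, (ii) t is a deadlock string of L, i.e., for every σ ∈ Σ, tσ ∉ L, and (iii) t is not a prefix of any string of M. Then every sublanguage K ⊆ M that is controllable with respect to (L, Σ_uc) is empty. -/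
/-! Abstract supervisory control theory notions over a finite alphabet `E`.
Languages are sets of finite strings (lists) over `E`. -/

variable {E : Type*}

/-- A string of `L` made of uncontrollable events lies in the prefix closure of every nonempty
controllable `K`. -/
theorem IsControllable.mem_prefixClosure {K L : Set (List E)} {Euc : Set E}
    (hK : IsControllable K L Euc) (hne : K.Nonempty) (hL : prefixClosure L = L) (t : List E)
    (htL : t ∈ L) (huc : ∀ σ ∈ t, σ ∈ Euc) : t ∈ prefixClosure K := by
  induction t using List.reverseRecOn with
  | nil =>
    obtain ⟨k, hk⟩ := hne
    exact ⟨k, hk, List.nil_prefix⟩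
  | append_singleton s σ ih =>
    have hs : s ∈ L := hL ▸ ⟨s ++ [σ], htL, List.prefix_append s [σ]⟩
    exact hK s (ih hs fun a ha => huc a (by simp [ha])) σ (huc σ (by simp)) htL

/-- if `L` contains a string `t` consisting solely of uncontrollable
events, which is a deadlock string of `L` and is a prefix of no string of `M`, then every
controllable sublanguage of `M` is empty. -/
theorem stmt4 [Fintype E] (L M : Set (List E)) (Euc : Set E)
    (hLpc : prefixClosure L = L) (hML : M ⊆ L)
    (t : List E) (htL : t ∈ L)
    (huc : ∀ σ ∈ t, σ ∈ Euc)
    (hdead : ∀ σ : E, t ++ [σ] ∉ L)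
    (hnpref : ∀ u ∈ M, ¬ t <+: u) :
    ∀ K ⊆ M, IsControllable K L Euc → K = ∅ := by
  intro K hKM hK
  by_contra hne
  obtain ⟨u, hu, htu⟩ :=
    hK.mem_prefixClosure (Set.nonempty_iff_ne_empty.mpr hne) hLpc t htL huc
  exact hnpref u (hKM hu) htu
end

section
/- For every string s in the language L(G_nom) generated by the nominal ABP system, the subsequence of s consisting of its occurrences of the events send and deliver is a prefix of the infinite alternating sequence send, deliver, send, deliver, … (in particular, deliver never occurs before the first send, and between two consecutive occurrences of send there is exactly one deliver). Equivalently, the safety monitor with states q0 (initial), q1, q2 and transitions q0−send→q1, q1−deliver→q0, q0−deliver→q2, q1−send→q2 never reaches q2 along any string of L(G_nom). -/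
/-! Model of the Alternating Bit Protocol (ABP) as a synchronous composition of
finite-state automata, following Alur et al. and the paper's Section 4. -/

/-- Events of the ABP system. -/
inductive Ev
  | send | done | timeout | deliver
  | p0 | p1 | p0' | p1'
  | a0 | a1 | a0' | a1'
  deriving DecidableEq

/-- Sender states. -/
inductive SSt | s0 | s1 | s2 | s3 | s4 | s5 | s6 | s7 deriving DecidableEq
/-- Receiver states. -/
inductive RSt | r0 | r1 | r2 | r3 | r4 | r5 deriving DecidableEq
/-- Forward channel states. -/
inductive FSt | f0 | f1 | f2 deriving DecidableEq
/-- Backward channel states. -/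
inductive BSt | b0 | b1 | b2 deriving DecidableEq
/-- Sending client states. -/
inductive CSt | c0 | c1 deriving DecidableEq

/-- Sender (ABP sender) transitions. -/
def sndTrans : List (SSt × Ev × SSt) :=
  [(.s0, .a0', .s0), (.s0, .a1', .s0), (.s0, .timeout, .s0), (.s0, .send, .s1),
   (.s1, .p0, .s2), (.s2, .send, .s1), (.s2, .timeout, .s1), (.s2, .a1', .s2), (.s2, .a0', .s3),
   (.s3, .done, .s4), (.s4, .a0', .s4), (.s4, .timeout, .s4), (.s4, .send, .s5), (.s4, .a1', .s5),
   (.s5, .p1, .s6), (.s6, .send, .s5), (.s6, .timeout, .s5), (.s6, .a1', .s7), (.s7, .done, .s0)]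

/-- Receiver (ABP receiver) transitions. -/
def rcvTrans : List (RSt × Ev × RSt) :=
  [(.r0, .p0', .r1), (.r0, .p1', .r5), (.r1, .deliver, .r2), (.r2, .a0, .r3),
   (.r3, .p0', .r2), (.r3, .p1', .r4), (.r4, .deliver, .r0), (.r5, .a1, .r0)]

/-- Nominal (nondeterministic) forward channel transitions. -/
def fcTrans : List (FSt × Ev × FSt) :=
  [(.f0, .p0, .f0), (.f0, .p1, .f0), (.f0, .p0, .f1), (.f0, .p1, .f2),
   (.f1, .p0, .f1), (.f1, .p1, .f1), (.f1, .p0', .f1), (.f1, .p0', .f0),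
   (.f2, .p0, .f2), (.f2, .p1, .f2), (.f2, .p1', .f2), (.f2, .p1', .f0)]

/-- Nominal (nondeterministic) backward channel transitions. -/
def bcTrans : List (BSt × Ev × BSt) :=
  [(.b0, .a0, .b0), (.b0, .a1, .b0), (.b0, .a0, .b1), (.b0, .a1, .b2),
   (.b1, .a0, .b1), (.b1, .a1, .b1), (.b1, .a0', .b1), (.b1, .a0', .b0),
   (.b2, .a0, .b2), (.b2, .a1, .b2), (.b2, .a1', .b2), (.b2, .a1', .b0)]

/-- Sending client transitions. -/
def scTrans : List (CSt × Ev × CSt) :=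
  [(.c0, .done, .c0), (.c0, .send, .c1), (.c1, .done, .c0)]

/-- Component alphabets. -/
def sndAlph (e : Ev) : Prop := e ∈ ([.send, .done, .timeout, .p0, .p1, .a0', .a1'] : List Ev)
def rcvAlph (e : Ev) : Prop := e ∈ ([.deliver, .p0', .p1', .a0, .a1] : List Ev)
def fcAlph (e : Ev) : Prop := e ∈ ([.p0, .p1, .p0', .p1'] : List Ev)
def bcAlph (e : Ev) : Prop := e ∈ ([.a0, .a1, .a0', .a1'] : List Ev)
def scAlph (e : Ev) : Prop := e ∈ ([.send, .done] : List Ev)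

/-- Synchronization of one component: if the event is in the component's alphabet, the
component must execute a transition on it; otherwise the component does not move.
(The one-state receiving client with self-loop `deliver` and the one-state timer with
self-loop `timeout` never constrain nor change anything, so they are left implicit.) -/
def sync {Q : Type*} (alph : Ev → Prop) (trans : List (Q × Ev × Q))
    (q : Q) (e : Ev) (q' : Q) : Prop :=
  (alph e ∧ (q, e, q') ∈ trans) ∨ (¬ alph e ∧ q' = q)

/-- Global states of the ABP system. -/
structure GSt where
  snd : SSt
  rcv : RSt
  fc : FSt
  bc : BSt
  sc : CSt
  deriving DecidableEq

/-- Global step of the synchronous composition, parametrized by the sender, forward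
channel and sending-client transition lists (these vary across the setups). -/
def gstep (sT : List (SSt × Ev × SSt)) (fT : List (FSt × Ev × FSt))
    (cT : List (CSt × Ev × CSt)) (q : GSt) (e : Ev) (q' : GSt) : Prop :=
  sync sndAlph sT q.snd e q'.snd ∧
  sync rcvAlph rcvTrans q.rcv e q'.rcv ∧
  sync fcAlph fT q.fc e q'.fc ∧
  sync bcAlph bcTrans q.bc e q'.bc ∧
  sync scAlph cT q.sc e q'.sc

/-- Runs of the composition: `Reach step q0 s q` iff the string `s` can be executed from
`q0`, ending in global state `q`. -/
inductive Reach (step : GSt → Ev → GSt → Prop) (q0 : GSt) : List Ev → GSt → Prop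
  | nil : Reach step q0 [] q0
  | snoc {s : List Ev} {q : GSt} {e : Ev} {q' : GSt} :
      Reach step q0 s q → step q e q' → Reach step q0 (s ++ [e]) q'

/-- Initial global state. -/
def init : GSt := ⟨.s0, .r0, .f0, .b0, .c0⟩

/-- Generated language of the composition. -/
def Lang (step : GSt → Ev → GSt → Prop) : Set (List Ev) :=
  {s | ∃ q, Reach step init s q}

/-- The nominal ABP system `G_nom`. -/
def nomStep : GSt → Ev → GSt → Prop := gstep sndTrans fcTrans scTrans

/-- Inductive invariant of the nominal ABP system. The Boolean `pending` records whether a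
`send` has occurred that has not yet been followed by a `deliver`. -/
def NomInv (q : GSt) (pending : Bool) : Prop :=
  match q.snd with
  | .s0 | .s7 => q.sc = (if q.snd = .s0 then .c0 else .c1) ∧ (q.rcv = .r0 ∨ q.rcv = .r5) ∧
      q.fc ≠ .f1 ∧ q.bc ≠ .b1 ∧ pending = false
  | .s1 | .s2 => q.sc = .c1 ∧
      ((q.rcv = .r0 ∨ q.rcv = .r5) ∧ q.bc ≠ .b1 ∧ pending = true ∨
        q.rcv = .r1 ∧ q.fc ≠ .f2 ∧ q.bc ≠ .b1 ∧ pending = true ∨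
        (q.rcv = .r2 ∨ q.rcv = .r3) ∧ q.fc ≠ .f2 ∧ pending = false)
  | .s3 | .s4 => q.sc = (if q.snd = .s4 then .c0 else .c1) ∧ (q.rcv = .r2 ∨ q.rcv = .r3) ∧
      q.fc ≠ .f2 ∧ q.bc ≠ .b2 ∧ pending = false
  | .s5 | .s6 => q.sc = .c1 ∧
      ((q.rcv = .r2 ∨ q.rcv = .r3) ∧ q.bc ≠ .b2 ∧ pending = true ∨
        q.rcv = .r4 ∧ q.fc ≠ .f1 ∧ q.bc ≠ .b2 ∧ pending = true ∨
        (q.rcv = .r0 ∨ q.rcv = .r5) ∧ q.fc ≠ .f1 ∧ pending = false)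

/-- Every step of the nominal system preserves the invariant; moreover `send` occurs only when
nothing is pending, and `deliver` only when something is. -/
theorem NomInv.step {q q' : GSt} {e : Ev} {pending : Bool} (hq : NomInv q pending)
    (h : nomStep q e q') :
    (e = .send → pending = false ∧ NomInv q' true) ∧
    (e = .deliver → pending = true ∧ NomInv q' false) ∧
    (e ≠ .send → e ≠ .deliver → NomInv q' pending) := by
  obtain ⟨s, r, f, b, c⟩ := q
  obtain ⟨s', r', f', b', c'⟩ := q'
  obtain ⟨hs, hr, hf, hb, hc⟩ := h
  cases e <;>
    simp [sync, sndAlph, rcvAlph, fcAlph, bcAlph, scAlph, sndTrans, rcvTrans, fcTrans, bcTrans,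
      scTrans] at hs hr hf hb hc <;>
    cases s <;> simp [NomInv] at hs hq ⊢ <;> grind

/-- A run ending in `q` produces a `send`/`deliver` projection which alternates, and whose last
event is described by a flag satisfying the invariant at `q`. -/
theorem Reach.exists_filter_eq {s : List Ev} {q : GSt} (h : Reach nomStep init s q) :
    ∃ (n : ℕ) (pending : Bool), NomInv q pending ∧
      s.filter (fun e => decide (e = Ev.send ∨ e = Ev.deliver)) =
        (List.replicate n [Ev.send, Ev.deliver]).flatten ++
          (if pending then [Ev.send] else []) := by
  induction h with
  | nil => exact ⟨0, false, by simp [NomInv, init], by simp⟩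
  | @snoc s q e q' _ hstep ih =>
    obtain ⟨n, pending, hinv, hfilter⟩ := ih
    obtain ⟨hsend, hdeliver, hother⟩ := hinv.step hstep
    by_cases h₁ : e = .send
    · obtain ⟨rfl, hinv'⟩ := hsend h₁
      exact ⟨n, true, hinv', by rw [List.filter_append, hfilter]; simp [h₁]⟩
    · by_cases h₂ : e = .deliver
      · obtain ⟨rfl, hinv'⟩ := hdeliver h₂
        exact ⟨n + 1, false, hinv', by
          rw [List.filter_append, hfilter]; simp [h₂, List.replicate_succ']⟩
      · exact ⟨n, pending, hother h₁ h₂, by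
          rw [List.filter_append, hfilter]; simp [h₁, h₂]⟩

/-- along every string of `L(G_nom)`, the subsequence of occurrences of
`send` and `deliver` is a prefix of the infinite alternating sequence
`send, deliver, send, deliver, …`. -/
theorem stmt5 (s : List Ev) (hs : s ∈ Lang nomStep) :
    ∃ n : ℕ,
      s.filter (fun e => decide (e = Ev.send ∨ e = Ev.deliver)) <+:
        (List.replicate n [Ev.send, Ev.deliver]).flatten := by
  obtain ⟨q, hq⟩ := hs
  obtain ⟨n, pending, -, hfilter⟩ := hq.exists_filter_eq
  refine ⟨n + 1, ?_⟩
  rw [hfilter, List.replicate_succ', List.flatten_append]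
  cases pending <;> simp
end

section
/- For every string s in the language L(G_nom) generated by the nominal ABP system, the subsequence of s consisting of its occurrences of the events deliver and done is a prefix of the infinite alternating sequence deliver, done, deliver, done, … (in particular, done never occurs before the first deliver, and between two consecutive occurrences of deliver there is exactly one done). -/
/-- Inductive invariant of the nominal system. -/
def abpInv (q : GSt) : Prop :=
  match q.snd, q.rcv with
  | .s0, .r0 | .s0, .r5 => q.fc ≠ .f1 ∧ q.bc ≠ .b1
  | .s1, .r0 | .s2, .r0 | .s1, .r5 | .s2, .r5 => q.bc ≠ .b1
  | .s1, .r1 | .s2, .r1 => q.fc ≠ .f2 ∧ q.bc ≠ .b1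
  | .s1, .r2 | .s2, .r2 | .s1, .r3 | .s2, .r3 => q.fc ≠ .f2
  | .s3, .r2 | .s4, .r2 | .s3, .r3 | .s4, .r3 => q.fc ≠ .f2 ∧ q.bc ≠ .b2
  | .s5, .r2 | .s6, .r2 | .s5, .r3 | .s6, .r3 => q.bc ≠ .b2
  | .s5, .r4 | .s6, .r4 => q.fc ≠ .f1 ∧ q.bc ≠ .b2
  | .s5, .r0 | .s6, .r0 | .s5, .r5 | .s6, .r5 => q.fc ≠ .f1
  | .s7, .r0 | .s7, .r5 => q.fc ≠ .f1 ∧ q.bc ≠ .b1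
  | _, _ => False

/-- The last message has been delivered, but the sender has not yet reported `done`. -/
def donePending (q : GSt) : Bool :=
  match q.snd, q.rcv with
  | .s1, .r2 | .s2, .r2 | .s3, .r2 | .s1, .r3 | .s2, .r3 | .s3, .r3 => true
  | .s5, .r0 | .s6, .r0 | .s7, .r0 | .s5, .r5 | .s6, .r5 | .s7, .r5 => true
  | _, _ => false

lemma abpInv_init : abpInv init := by simp [abpInv, init]

set_option maxHeartbeats 2000000 in
lemma abpInv_step {q q' : GSt} {e : Ev} (hq : abpInv q) (h : nomStep q e q') :
    abpInv q' ∧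
      (e = .deliver → donePending q = false ∧ donePending q' = true) ∧
      (e = .done → donePending q = true ∧ donePending q' = false) ∧
      (e ≠ .deliver → e ≠ .done → donePending q' = donePending q) := by
  obtain ⟨s, r, f, b, c⟩ := q
  obtain ⟨s', r', f', b', c'⟩ := q'
  obtain ⟨hs, hr, hf, hb, -⟩ := h
  cases s <;> cases r <;> simp only [abpInv] at hq <;> cases e <;>
    simp [sync, sndAlph, rcvAlph, fcAlph, bcAlph, sndTrans, rcvTrans, fcTrans, bcTrans]
      at hs hr hf hb <;>
    subst_vars <;> grind [abpInv, donePending]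

lemma filter_eq_of_reach {s : List Ev} {q : GSt} (h : Reach nomStep init s q) :
    abpInv q ∧ ∃ n : ℕ,
      s.filter (fun e => decide (e = Ev.deliver ∨ e = Ev.done)) =
        (List.replicate n [Ev.deliver, Ev.done]).flatten ++
          if donePending q then [Ev.deliver] else [] := by
  induction h with
  | nil => exact ⟨abpInv_init, 0, by simp [donePending, init]⟩
  | @snoc s q e q' _ hstep ih =>
    obtain ⟨hq, n, hn⟩ := ih
    obtain ⟨hq', hdeliver, hdone, hother⟩ := abpInv_step hq hstep
    refine ⟨hq', ?_⟩
    rw [List.filter_append, hn]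
    by_cases h₁ : e = .deliver
    · obtain ⟨h, h'⟩ := hdeliver h₁
      exact ⟨n, by simp [h, h', h₁]⟩
    by_cases h₂ : e = .done
    · obtain ⟨h, h'⟩ := hdone h₂
      exact ⟨n + 1, by simp [h, h', h₂, List.replicate_succ']⟩
    · exact ⟨n, by simp [hother h₁ h₂, h₁, h₂]⟩

/-- along every string of `L(G_nom)`, the subsequence of occurrences of
`deliver` and `done` is a prefix of the infinite alternating sequence
`deliver, done, deliver, done, …`. -/
theorem stmt6 (s : List Ev) (hs : s ∈ Lang nomStep) :
    ∃ n : ℕ,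
      s.filter (fun e => decide (e = Ev.deliver ∨ e = Ev.done)) <+:
        (List.replicate n [Ev.deliver, Ev.done]).flatten := by
  obtain ⟨q, hq⟩ := hs
  obtain ⟨-, n, hn⟩ := filter_eq_of_reach hq
  refine ⟨n + 1, ?_⟩
  rw [hn, List.replicate_succ', List.flatten_append]
  cases donePending q <;> simp
end

section
/- In the ABP system G_a in which the forward channel is under person-in-the-middle attack, the string send · p0 · p0' · deliver · a0 · p1' · deliver belongs to L(G_a). Its subsequence of occurrences of the events send and deliver is send, deliver, deliver, which is not a prefix of the alternating sequence send, deliver, send, deliver, …; hence the attacked ABP system can violate the safety property that send and deliver strictly alternate starting with send. -/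
/-- Forward channel under the person-in-the-middle attack: the nominal transitions plus
the attacker's extra transitions (sending the wrong primed packet). -/
def fcTransAtk : List (FSt × Ev × FSt) :=
  fcTrans ++
  [(.f1, .p1', .f1), (.f1, .p1', .f0), (.f2, .p0', .f2), (.f2, .p0', .f0)]

/-- The attacked ABP system `G_a` (forward channel under attack). -/
def atkStep : GSt → Ev → GSt → Prop := gstep sndTrans fcTransAtk scTrans

/-- The attack string `send · p0 · p0' · deliver · a0 · p1' · deliver`. -/
def attackStr : List Ev :=
  [.send, .p0, .p0', .deliver, .a0, .p1', .deliver]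

instance : DecidablePred sndAlph := fun _ => List.instDecidableMemOfLawfulBEq _ _
instance : DecidablePred rcvAlph := fun _ => List.instDecidableMemOfLawfulBEq _ _
instance : DecidablePred fcAlph := fun _ => List.instDecidableMemOfLawfulBEq _ _
instance : DecidablePred bcAlph := fun _ => List.instDecidableMemOfLawfulBEq _ _
instance : DecidablePred scAlph := fun _ => List.instDecidableMemOfLawfulBEq _ _

instance decidableSync {Q : Type*} [DecidableEq Q] (alph : Ev → Prop) [DecidablePred alph]
    (trans : List (Q × Ev × Q)) (q : Q) (e : Ev) (q' : Q) :
    Decidable (sync alph trans q e q') :=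
  inferInstanceAs (Decidable ((alph e ∧ (q, e, q') ∈ trans) ∨ (¬ alph e ∧ q' = q)))

instance decidableGstep (sT : List (SSt × Ev × SSt)) (fT : List (FSt × Ev × FSt))
    (cT : List (CSt × Ev × CSt)) (q : GSt) (e : Ev) (q' : GSt) :
    Decidable (gstep sT fT cT q e q') := by
  unfold gstep
  infer_instance

instance decidableAtkStep (q : GSt) (e : Ev) (q' : GSt) : Decidable (atkStep q e q') :=
  decidableGstep _ _ _ q e q'

theorem attackStr_mem_lang : attackStr ∈ Lang atkStep := by
  have h₁ : atkStep init .send ⟨.s1, .r0, .f0, .b0, .c1⟩ := by decide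
  have h₂ : atkStep ⟨.s1, .r0, .f0, .b0, .c1⟩ .p0 ⟨.s2, .r0, .f1, .b0, .c1⟩ := by decide
  have h₃ : atkStep ⟨.s2, .r0, .f1, .b0, .c1⟩ .p0' ⟨.s2, .r1, .f1, .b0, .c1⟩ := by decide
  have h₄ : atkStep ⟨.s2, .r1, .f1, .b0, .c1⟩ .deliver ⟨.s2, .r2, .f1, .b0, .c1⟩ := by decide
  have h₅ : atkStep ⟨.s2, .r2, .f1, .b0, .c1⟩ .a0 ⟨.s2, .r3, .f1, .b0, .c1⟩ := by decide
  have h₆ : atkStep ⟨.s2, .r3, .f1, .b0, .c1⟩ .p1' ⟨.s2, .r4, .f0, .b0, .c1⟩ := by decide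
  have h₇ : atkStep ⟨.s2, .r4, .f0, .b0, .c1⟩ .deliver ⟨.s2, .r0, .f0, .b0, .c1⟩ := by decide
  exact ⟨_, ((((((Reach.nil.snoc h₁).snoc h₂).snoc h₃).snoc h₄).snoc h₅).snoc h₆).snoc h₇⟩

theorem not_prefix_alternating (n : ℕ) :
    ¬ [Ev.send, Ev.deliver, Ev.deliver] <+:
      (List.replicate n [Ev.send, Ev.deliver]).flatten := by
  rcases n with _ | _ | n <;> simp [List.replicate_succ]

/-- the attack string belongs to `L(G_a)`; its subsequence of
occurrences of `send` and `deliver` is `send, deliver, deliver`, which is not a prefix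
of the alternating sequence `send, deliver, send, deliver, …`; hence the attacked ABP
system violates the safety property that `send` and `deliver` strictly alternate
starting with `send`. -/
theorem stmt7 :
    attackStr ∈ Lang atkStep ∧
    attackStr.filter (fun e => decide (e = Ev.send ∨ e = Ev.deliver)) =
      [Ev.send, Ev.deliver, Ev.deliver] ∧
    ¬ ∃ n : ℕ,
        attackStr.filter (fun e => decide (e = Ev.send ∨ e = Ev.deliver)) <+:
          (List.replicate n [Ev.send, Ev.deliver]).flatten := by
  have hf : attackStr.filter (fun e => decide (e = Ev.send ∨ e = Ev.deliver)) =
      [Ev.send, Ev.deliver, Ev.deliver] := by decide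
  refine ⟨attackStr_mem_lang, hf, ?_⟩
  rintro ⟨n, hn⟩
  exact not_prefix_alternating n (hf ▸ hn)
end
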